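/- Define ψ(x) := ∫_{−∞}^∞ (x−y)² sgn(y) e^{−(|x|+|y|)²/2}/√(2π) dy for x ∈ ℝ, with sgn(0)=0. Then ψ is Lebesgue integrable on (0,∞) and ∫_0^∞ ψ(x) dx = 2( E[|N|³]/3 − E[|N|] ) = −2√2/(3√π), where N is a standard Gaussian random variable. -/

import Mathlib

open MeasureTheory ProbabilityTheory Real Set

/-- `ψ(x) := ∫_{−∞}^∞ (x−y)² sgn(y) e^{−(|x|+|y|)²/2}/√(2π) dy`, with `sgn(0)=0`. -/
noncomputable def psiFun (x : ℝ) : ℝ :=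
  ∫ y : ℝ, (x - y) ^ 2 * Real.sign y * (Real.exp (-(|x| + |y|) ^ 2 / 2) / Real.sqrt (2 * Real.pi))

open Filter Topology

/-- The unnormalised standard Gaussian upper tail `∫_x^∞ e^{-s²/2} ds`. -/
noncomputable def gaussTail (x : ℝ) : ℝ := ∫ s in Ioi x, exp (-s ^ 2 / 2)

lemma integrable_pow_mul_exp_neg_sq_div_two (n : ℕ) :
    Integrable fun s : ℝ => s ^ n * exp (-s ^ 2 / 2) := by
  have h := integrable_rpow_mul_exp_neg_mul_sq (b := 1 / 2) (by norm_num) (s := (n : ℝ))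
    (by linarith [n.cast_nonneg (α := ℝ)])
  refine h.congr (ae_of_all _ fun s => ?_)
  simp only [rpow_natCast]
  congr 2
  ring

lemma integrable_exp_neg_sq_div_two : Integrable fun s : ℝ => exp (-s ^ 2 / 2) := by
  simpa using integrable_pow_mul_exp_neg_sq_div_two 0

lemma integrable_mul_exp_neg_sq_div_two : Integrable fun s : ℝ => s * exp (-s ^ 2 / 2) := by
  simpa using integrable_pow_mul_exp_neg_sq_div_two 1

lemma tendsto_pow_mul_exp_neg_sq_div_two_atTop (n : ℕ) :
    Tendsto (fun s : ℝ => s ^ n * exp (-s ^ 2 / 2)) atTop (𝓝 0) := by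
  have h := tendsto_pow_mul_exp_neg_atTop_nhds_zero n
  refine squeeze_zero' ?_ ?_ h
  · filter_upwards [eventually_ge_atTop 0] with s hs
    positivity
  · filter_upwards [eventually_ge_atTop 2] with s hs
    have : -s ^ 2 / 2 ≤ -s := by nlinarith
    gcongr

lemma hasDerivAt_exp_neg_sq_div_two (s : ℝ) :
    HasDerivAt (fun s : ℝ => exp (-s ^ 2 / 2)) (-(s * exp (-s ^ 2 / 2))) s := by
  have h : HasDerivAt (fun s : ℝ => -s ^ 2 / 2) (-s) s := by
    refine ((hasDerivAt_pow 2 s).fun_neg.div_const 2).congr_deriv ?_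
    simp
    ring
  convert h.exp using 1
  ring

lemma integral_Ioi_mul_exp_neg_sq_div_two (x : ℝ) :
    ∫ s in Ioi x, s * exp (-s ^ 2 / 2) = exp (-x ^ 2 / 2) := by
  have hlim := (tendsto_pow_mul_exp_neg_sq_div_two_atTop 0).neg
  simp only [pow_zero, one_mul, neg_zero] at hlim
  have h := integral_Ioi_of_hasDerivAt_of_tendsto' (a := x)
    (f := fun s : ℝ => -exp (-s ^ 2 / 2)) (f' := fun s => s * exp (-s ^ 2 / 2))
    (fun s _ => by simpa using (hasDerivAt_exp_neg_sq_div_two s).fun_neg)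
    integrable_mul_exp_neg_sq_div_two.integrableOn hlim
  simpa using h

lemma integral_Ioi_pow_three_mul_exp_neg_sq_div_two :
    ∫ s in Ioi (0 : ℝ), s ^ 3 * exp (-s ^ 2 / 2) = 2 := by
  have hlim := ((tendsto_pow_mul_exp_neg_sq_div_two_atTop 2).add
    ((tendsto_pow_mul_exp_neg_sq_div_two_atTop 0).const_mul 2)).neg
  have h := integral_Ioi_of_hasDerivAt_of_tendsto' (a := 0)
    (f' := fun s => s ^ 3 * exp (-s ^ 2 / 2))
    (fun s _ => by
      have hd := hasDerivAt_exp_neg_sq_div_two s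
      refine (((((hasDerivAt_pow 2 s).fun_mul hd).fun_add
        (((hasDerivAt_pow 0 s).fun_mul hd).const_mul 2)).fun_neg).congr_deriv ?_)
      simp
      ring)
    (integrable_pow_mul_exp_neg_sq_div_two 3).integrableOn hlim
  simpa using h

lemma hasDerivAt_gaussTail (x : ℝ) : HasDerivAt gaussTail (-exp (-x ^ 2 / 2)) x := by
  have hc : Continuous fun s : ℝ => exp (-s ^ 2 / 2) := by fun_prop
  have h : gaussTail = fun u => gaussTail 0 - ∫ s in (0 : ℝ)..u, exp (-s ^ 2 / 2) := by
    funext u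
    rw [← intervalIntegral.integral_Ioi_sub_Ioi' integrable_exp_neg_sq_div_two.integrableOn
      integrable_exp_neg_sq_div_two.integrableOn]
    simp [gaussTail]
  rw [h]
  exact (hc.integral_hasStrictDerivAt 0 x).hasDerivAt.const_sub _

lemma gaussTail_nonneg (x : ℝ) : 0 ≤ gaussTail x := by
  unfold gaussTail
  positivity

lemma mul_gaussTail_le (x : ℝ) : x * gaussTail x ≤ exp (-x ^ 2 / 2) := by
  rw [← integral_Ioi_mul_exp_neg_sq_div_two, gaussTail, ← integral_const_mul]
  refine setIntegral_mono_on (integrable_exp_neg_sq_div_two.const_mul x).integrableOn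
    integrable_mul_exp_neg_sq_div_two.integrableOn measurableSet_Ioi fun s hs => ?_
  have : x ≤ s := le_of_lt hs
  gcongr

lemma tendsto_pow_three_mul_gaussTail_atTop :
    Tendsto (fun x : ℝ => x ^ 3 * gaussTail x) atTop (𝓝 0) := by
  refine squeeze_zero' ?_ ?_ (tendsto_pow_mul_exp_neg_sq_div_two_atTop 2)
  · filter_upwards [eventually_ge_atTop 0] with x hx
    have := gaussTail_nonneg x
    positivity
  · refine Eventually.of_forall fun x => ?_
    nlinarith [mul_le_mul_of_nonneg_left (mul_gaussTail_le x) (sq_nonneg x)]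

lemma integral_Ioi_zero_comp_add_left (f : ℝ → ℝ) (x : ℝ) :
    ∫ y in Ioi (0 : ℝ), f (x + y) = ∫ s in Ioi x, f s := by
  have h := (measurePreserving_add_left volume x).setIntegral_preimage_emb
    (measurableEmbedding_addLeft x) f (Ioi x)
  simpa using h

/-- Closed form of `ψ` on the positive half-line. -/
lemma psiFun_of_pos {x : ℝ} (hx : 0 < x) :
    psiFun x = -(4 / √(2 * π)) * (x * exp (-x ^ 2 / 2) - x ^ 2 * gaussTail x) := by
  set c := √(2 * π)
  have h0 := integrable_exp_neg_sq_div_two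
  have h1 := integrable_mul_exp_neg_sq_div_two
  have h2 := integrable_pow_mul_exp_neg_sq_div_two 2
  set f : ℝ → ℝ := fun y => (x - y) ^ 2 * Real.sign y * (exp (-(|x| + |y|) ^ 2 / 2) / c) with hf
  set P : ℝ → ℝ := fun s => (2 * x - s) ^ 2 * (exp (-s ^ 2 / 2) / c) with hP
  set Q : ℝ → ℝ := fun s => s ^ 2 * (exp (-s ^ 2 / 2) / c) with hQ
  have hPi : Integrable P := by
    refine ((((h0.const_mul (4 * x ^ 2)).sub (h1.const_mul (4 * x))).add h2).div_const c).congr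
      (ae_of_all _ fun s => ?_)
    simp only [hP, Pi.add_apply, Pi.sub_apply]
    ring
  have hQi : Integrable Q := by
    refine (h2.div_const c).congr (ae_of_all _ fun s => ?_)
    simp only [hQ]
    ring
  have hfpos : ∀ y ∈ Ioi (0 : ℝ), f y = P (x + y) := fun y (hy : 0 < y) => by
    simp only [hf, hP, Real.sign_of_pos hy, abs_of_pos hx, abs_of_pos hy]
    ring
  have hfneg : ∀ y ∈ Ioi (0 : ℝ), f (-y) = -Q (x + y) := fun y (hy : 0 < y) => by
    simp only [hf, hQ, Real.sign_of_neg (neg_lt_zero.mpr hy), abs_of_pos hx, abs_neg,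
      abs_of_pos hy]
    ring
  have hfposi : IntegrableOn f (Ioi 0) :=
    (integrableOn_congr_fun hfpos measurableSet_Ioi).mpr (hPi.comp_add_left x).integrableOn
  have hfnegi : IntegrableOn f (Iic 0) := by
    rw [integrableOn_Iic_iff_integrableOn_Iio]
    have h := (integrableOn_congr_fun hfneg measurableSet_Ioi).mpr
      (hQi.comp_add_left x).neg.integrableOn
    simpa using h.comp_neg
  have hpsi : psiFun x = ∫ y, f y := rfl
  rw [hpsi, ← intervalIntegral.integral_Iic_add_Ioi hfnegi hfposi, ← neg_zero,
    ← integral_comp_neg_Ioi, neg_zero, setIntegral_congr_fun measurableSet_Ioi hfpos,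
    setIntegral_congr_fun measurableSet_Ioi hfneg, integral_neg,
    integral_Ioi_zero_comp_add_left, integral_Ioi_zero_comp_add_left, neg_add_eq_sub,
    ← integral_sub hPi.integrableOn hQi.integrableOn,
    ← integral_Ioi_mul_exp_neg_sq_div_two x, gaussTail, ← integral_const_mul,
    ← integral_const_mul, ← integral_sub (h1.const_mul x).integrableOn
      (h0.const_mul (x ^ 2)).integrableOn, ← integral_const_mul]
  refine integral_congr_ae (ae_of_all _ fun s => ?_)
  simp only [hP, hQ]
  ring

lemma integral_Ioi_mul_exp_sub_sq_mul_gaussTail :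
    IntegrableOn (fun x : ℝ => x * exp (-x ^ 2 / 2) - x ^ 2 * gaussTail x) (Ioi 0) ∧
    ∫ x in Ioi (0 : ℝ), (x * exp (-x ^ 2 / 2) - x ^ 2 * gaussTail x) = 1 / 3 := by
  have hlim := ((((tendsto_pow_mul_exp_neg_sq_div_two_atTop 2).sub
    (tendsto_pow_mul_exp_neg_sq_div_two_atTop 0)).sub
      tendsto_pow_three_mul_gaussTail_atTop).div_const 3)
  have hderiv : ∀ x ∈ Ici (0 : ℝ), HasDerivAt
      (fun x : ℝ => (x ^ 2 * exp (-x ^ 2 / 2) - x ^ 0 * exp (-x ^ 2 / 2)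
        - x ^ 3 * gaussTail x) / 3)
      (x * exp (-x ^ 2 / 2) - x ^ 2 * gaussTail x) x := fun x _ => by
    have hd := hasDerivAt_exp_neg_sq_div_two x
    refine ((((((hasDerivAt_pow 2 x).fun_mul hd).fun_sub
      ((hasDerivAt_pow 0 x).fun_mul hd)).fun_sub
      ((hasDerivAt_pow 3 x).fun_mul (hasDerivAt_gaussTail x))).div_const 3).congr_deriv ?_)
    simp
    ring
  have hpos : ∀ x ∈ Ioi (0 : ℝ), 0 ≤ x * exp (-x ^ 2 / 2) - x ^ 2 * gaussTail x :=
    fun x (hx : 0 < x) => by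
      nlinarith [mul_le_mul_of_nonneg_left (mul_gaussTail_le x) hx.le]
  refine ⟨integrableOn_Ioi_deriv_of_nonneg' hderiv hpos hlim, ?_⟩
  rw [integral_Ioi_of_hasDerivAt_of_nonneg' hderiv hpos hlim]
  norm_num

lemma integral_comp_abs_gaussianReal (f : ℝ → ℝ) :
    ∫ t, f |t| ∂(gaussianReal 0 1)
      = 2 / √(2 * π) * ∫ t in Ioi (0 : ℝ), f t * exp (-t ^ 2 / 2) := by
  have h := integral_comp_abs (f := fun t => (√(2 * π))⁻¹ * (f t * exp (-t ^ 2 / 2)))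
  rw [integral_gaussianReal_eq_integral_smul one_ne_zero, div_eq_mul_inv, mul_assoc,
    ← integral_const_mul, ← h]
  refine integral_congr_ae (ae_of_all _ fun t => ?_)
  simp [gaussianPDFReal]
  ring

/-- `ψ` is Lebesgue integrable on `(0,∞)` and
`∫_0^∞ ψ(x) dx = 2( E[|N|³]/3 − E[|N|] ) = −2√2/(3√π)`. -/
theorem integral_psiFun_Ioi :
    IntegrableOn psiFun (Set.Ioi (0 : ℝ)) volume ∧
    (∫ x in Set.Ioi (0 : ℝ), psiFun x)
      = 2 * ((∫ t, |t| ^ 3 ∂(gaussianReal 0 1)) / 3 - ∫ t, |t| ∂(gaussianReal 0 1)) ∧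
    (∫ x in Set.Ioi (0 : ℝ), psiFun x) = -(2 * Real.sqrt 2) / (3 * Real.sqrt Real.pi) := by
  have hcongr : EqOn psiFun
      (fun x => -(4 / √(2 * π)) * (x * exp (-x ^ 2 / 2) - x ^ 2 * gaussTail x)) (Ioi 0) :=
    fun x hx => psiFun_of_pos hx
  have hval : ∫ x in Ioi (0 : ℝ), psiFun x = -(4 / √(2 * π)) * (1 / 3) := by
    rw [setIntegral_congr_fun measurableSet_Ioi hcongr, integral_const_mul, integral_Ioi_mul_exp_sub_sq_mul_gaussTail.2]
  refine ⟨(integrableOn_congr_fun hcongr measurableSet_Ioi).mpr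
    (integral_Ioi_mul_exp_sub_sq_mul_gaussTail.1.const_mul _), ?_, ?_⟩
  · rw [hval, integral_comp_abs_gaussianReal (fun t => t ^ 3),
      integral_comp_abs_gaussianReal (fun t => t),
      integral_Ioi_pow_three_mul_exp_neg_sq_div_two, integral_Ioi_mul_exp_neg_sq_div_two]
    norm_num
    ring
  · have h2 : √2 * √2 = 2 := mul_self_sqrt (by norm_num)
    have hπ : √π ≠ 0 := (sqrt_pos.mpr pi_pos).ne'
    rw [hval, sqrt_mul (by norm_num)]
    field_simp
    linarith
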